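/- arXiv:2312.17588 — 10 statements merged into one kernel-verified Lean document; each statement's English description precedes it below -/
import Mathlib

section
/- Let A, B be real n×n matrices, regarded as complex, and define P : ℂ × ℂ → ℂ by P(z, Y) = det(z·I − A − Y·B). Let ω_H > 0 and τ_H > 0. Suppose γ, φ : ℝ → ℝ are differentiable at ω_H with γ(ω_H) = 0 and φ(ω_H) = ω_H·τ_H, and P(iω, e^{−γ(ω) − iφ(ω)}) = 0 for all ω in a neighborhood of ω_H. Suppose λ : ℝ → ℂ is differentiable at τ_H with λ(τ_H) = i·ω_H and P(λ(τ), e^{−τ·λ(τ)}) = 0 for all τ in a neighborhood of τ_H. Assume the derivative of the map Y ↦ P(i·ω_H, Y) at Y = e^{−i·ω_H·τ_H} is nonzero. Then τ_H − φ'(ω_H) + i·γ'(ω_H) ≠ 0 and λ'(τ_H) = −i·ω_H / (τ_H − φ'(ω_H) + i·γ'(ω_H)). -/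
open Matrix Complex

/-- `P(z, Y) = det(z I − A − Y B)`, where the real matrices `A`, `B` are regarded
as complex matrices. -/
noncomputable def genPoly (n : ℕ) (A B : Matrix (Fin n) (Fin n) ℝ) (z Y : ℂ) : ℂ :=
  (z • (1 : Matrix (Fin n) (Fin n) ℂ)
    - A.map Complex.ofReal - Y • B.map Complex.ofReal).det

/-- `P` is jointly differentiable. -/
lemma genPoly_differentiable (n : ℕ) (A B : Matrix (Fin n) (Fin n) ℝ) :
    Differentiable ℂ (fun p : ℂ × ℂ => genPoly n A B p.1 p.2) := by
  unfold genPoly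
  simp only [Matrix.det_apply, Matrix.sub_apply, Matrix.smul_apply, smul_eq_mul, Units.smul_def,
    zsmul_eq_mul]
  fun_prop

/-- Chain rule along a curve of zeros. -/
lemma curve_zero (F : ℂ × ℂ → ℂ) (z Y : ℝ → ℂ) (z' Y' : ℂ) (t : ℝ)
    (hF : DifferentiableAt ℂ F (z t, Y t))
    (hz : HasDerivAt z z' t) (hY : HasDerivAt Y Y' t)
    (h0 : ∀ᶠ s in nhds t, F (z s, Y s) = 0) :
    z' * fderiv ℂ F (z t, Y t) (1, 0) + Y' * fderiv ℂ F (z t, Y t) (0, 1) = 0 := by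
  have h1 := (hF.hasFDerivAt.restrictScalars ℝ).comp_hasDerivAt t (hz.prodMk hY)
  have h2 : HasDerivAt (F ∘ fun s => (z s, Y s)) 0 t :=
    (hasDerivAt_const t (0 : ℂ)).congr_of_eventuallyEq h0
  have h3 := h1.unique h2
  have h4 : ((z', Y') : ℂ × ℂ) = z' • ((1, 0) : ℂ × ℂ) + Y' • ((0, 1) : ℂ × ℂ) := by simp
  rw [h4] at h3
  simpa only [ContinuousLinearMap.coe_restrictScalars', map_add, map_smul, smul_eq_mul] using h3

/-- **Transversality Theorem (core derivative computation).** -/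
theorem stmt1 (n : ℕ) (A B : Matrix (Fin n) (Fin n) ℝ)
    (ωH τH : ℝ) (hωH : 0 < ωH) (hτH : 0 < τH)
    (γ φ : ℝ → ℝ) (γ' φ' : ℝ)
    (hγ : HasDerivAt γ γ' ωH) (hφ : HasDerivAt φ φ' ωH)
    (hγ0 : γ ωH = 0) (hφ0 : φ ωH = ωH * τH)
    (hACS : ∀ᶠ ω : ℝ in nhds ωH,
      genPoly n A B (Complex.I * ω) (Complex.exp (-(γ ω : ℂ) - Complex.I * (φ ω : ℂ))) = 0)
    (lamb : ℝ → ℂ) (lamb' : ℂ)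
    (hlamb : HasDerivAt lamb lamb' τH) (hlamb0 : lamb τH = Complex.I * ωH)
    (hroot : ∀ᶠ τ : ℝ in nhds τH, genPoly n A B (lamb τ) (Complex.exp (-(τ : ℂ) * lamb τ)) = 0)
    (hYd : deriv (fun Y : ℂ => genPoly n A B (Complex.I * ωH) Y)
      (Complex.exp (-(Complex.I * ωH * τH))) ≠ 0) :
    ((τH : ℂ) - (φ' : ℂ) + Complex.I * (γ' : ℂ) ≠ 0) ∧
      lamb' = -(Complex.I * ωH) / ((τH : ℂ) - (φ' : ℂ) + Complex.I * (γ' : ℂ)) := by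
  set F : ℂ × ℂ → ℂ := fun p => genPoly n A B p.1 p.2 with hFdef
  have hF : Differentiable ℂ F := genPoly_differentiable n A B
  set Y0 := Complex.exp (-(Complex.I * ωH * τH)) with hY0
  have hY0ne : Y0 ≠ 0 := Complex.exp_ne_zero _
  have e1 : Complex.exp (-(γ ωH : ℂ) - Complex.I * (φ ωH : ℂ)) = Y0 := by
    rw [hY0, hγ0, hφ0]; congr 1; push_cast; ring
  have e2 : Complex.exp (-(τH : ℂ) * lamb τH) = Y0 := by
    rw [hY0, hlamb0]; congr 1; ring
  have c1 := curve_zero F (fun ω : ℝ => Complex.I * ω)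
    (fun ω => Complex.exp (-(γ ω : ℂ) - Complex.I * (φ ω : ℂ))) _ _ ωH (hF _)
    ((Complex.ofRealCLM.hasDerivAt (x := ωH)).const_mul Complex.I)
    ((hγ.ofReal_comp.neg.sub (hφ.ofReal_comp.const_mul Complex.I)).cexp) hACS
  have c2 := curve_zero F lamb (fun τ : ℝ => Complex.exp (-(τ : ℂ) * lamb τ)) _ _ τH (hF _)
    hlamb (((Complex.ofRealCLM.hasDerivAt (x := τH)).neg.mul hlamb).cexp) hroot
  have hd : fderiv ℂ F (Complex.I * ωH, Y0) (0, 1) ≠ 0 := by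
    have h := (hF (Complex.I * ωH, Y0)).hasFDerivAt.comp_hasDerivAt Y0
      ((hasDerivAt_const Y0 (Complex.I * (ωH : ℂ))).prodMk (hasDerivAt_id Y0))
    have h' := h.deriv
    intro h0
    apply hYd
    rw [h0] at h'
    exact h'
  simp only [Pi.mul_apply, Pi.neg_apply, Pi.sub_apply, Complex.ofRealCLM_apply,
    Complex.ofReal_one] at c1 c2
  simp only [e1] at c1
  simp only [e2] at c2
  simp only [hlamb0] at c2
  set Pz := fderiv ℂ F (Complex.I * ωH, Y0) (1, 0)
  set PY := fderiv ℂ F (Complex.I * ωH, Y0) (0, 1)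
  have key : ((τH : ℂ) - (φ' : ℂ) + Complex.I * (γ' : ℂ)) * lamb' = -(Complex.I * ωH) := by
    have hm : Y0 * PY ≠ 0 := mul_ne_zero hY0ne hd
    apply mul_left_cancel₀ hm
    linear_combination (-1 : ℂ) * c2 - Complex.I * lamb' * c1 +
      (lamb' * Pz - lamb' * Y0 * PY * φ') * Complex.I_sq
  have hne : -(Complex.I * (ωH : ℂ)) ≠ 0 :=
    neg_ne_zero.mpr (mul_ne_zero Complex.I_ne_zero (Complex.ofReal_ne_zero.mpr hωH.ne'))
  have hD : ((τH : ℂ) - (φ' : ℂ) + Complex.I * (γ' : ℂ)) ≠ 0 := by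
    intro h
    rw [h, zero_mul] at key
    exact hne key.symm
  exact ⟨hD, by rw [eq_div_iff hD, mul_comm]; exact key⟩
end

section
/- Let A, B be real n×n matrices, regarded as complex, and define P : ℂ × ℂ → ℂ by P(z, Y) = det(z·I − A − Y·B). Let ω_H > 0 and τ_H > 0. Suppose γ, φ : ℝ → ℝ are differentiable at ω_H with γ(ω_H) = 0 and φ(ω_H) = ω_H·τ_H, and P(iω, e^{−γ(ω) − iφ(ω)}) = 0 for all ω in a neighborhood of ω_H. Suppose λ : ℝ → ℂ is differentiable at τ_H with λ(τ_H) = i·ω_H and P(λ(τ), e^{−τ·λ(τ)}) = 0 for all τ in a neighborhood of τ_H. Assume the derivative of the map Y ↦ P(i·ω_H, Y) at Y = e^{−i·ω_H·τ_H} is nonzero. Then Re λ'(τ_H) = −ω_H·γ'(ω_H) / ((τ_H − φ'(ω_H))² + (γ'(ω_H))²); in particular, Re λ'(τ_H) > 0 if γ'(ω_H) < 0 (destabilizing crossing), and Re λ'(τ_H) < 0 if γ'(ω_H) > 0 (stabilizing crossing). -/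
open Matrix Complex

/-- Chain rule for `P` along a real curve contained in its zero set. -/
lemma genPoly_chain (n : ℕ) (A B : Matrix (Fin n) (Fin n) ℝ) (f g : ℝ → ℂ) (f' g' : ℂ) (t : ℝ)
    (L : ℂ × ℂ →L[ℂ] ℂ)
    (hL : HasFDerivAt (fun p : ℂ × ℂ => genPoly n A B p.1 p.2) L (f t, g t))
    (hf : HasDerivAt f f' t) (hg : HasDerivAt g g' t)
    (h : ∀ᶠ s in nhds t, genPoly n A B (f s) (g s) = 0) :
    f' * L (1, 0) + g' * L (0, 1) = 0 := by
  have h1 := (hL.restrictScalars ℝ).comp_hasDerivAt t (hf.prodMk hg)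
  have h2 : HasDerivAt (fun _ : ℝ => (0 : ℂ)) 0 t := hasDerivAt_const _ _
  have h3 := h1.unique (h2.congr_of_eventuallyEq (by filter_upwards [h] with s hs using hs))
  have h4 : (f', g') = f' • ((1 : ℂ), (0 : ℂ)) + g' • ((0 : ℂ), (1 : ℂ)) := by simp
  have h5 : L (f', g') = 0 := h3
  rw [h4, map_add, map_smul, map_smul] at h5
  simpa using h5

/-- **Transversality Theorem (sign of the crossing).** -/
theorem stmt2 (n : ℕ) (A B : Matrix (Fin n) (Fin n) ℝ)
    (ωH τH : ℝ) (hωH : 0 < ωH) (hτH : 0 < τH)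
    (γ φ : ℝ → ℝ) (γ' φ' : ℝ)
    (hγ : HasDerivAt γ γ' ωH) (hφ : HasDerivAt φ φ' ωH)
    (hγ0 : γ ωH = 0) (hφ0 : φ ωH = ωH * τH)
    (hACS : ∀ᶠ ω : ℝ in nhds ωH,
      genPoly n A B (Complex.I * ω) (Complex.exp (-(γ ω : ℂ) - Complex.I * (φ ω : ℂ))) = 0)
    (lamb : ℝ → ℂ) (lamb' : ℂ)
    (hlamb : HasDerivAt lamb lamb' τH) (hlamb0 : lamb τH = Complex.I * ωH)
    (hroot : ∀ᶠ τ : ℝ in nhds τH, genPoly n A B (lamb τ) (Complex.exp (-(τ : ℂ) * lamb τ)) = 0)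
    (hYd : deriv (fun Y : ℂ => genPoly n A B (Complex.I * ωH) Y)
      (Complex.exp (-(Complex.I * ωH * τH))) ≠ 0) :
    lamb'.re = -ωH * γ' / ((τH - φ') ^ 2 + γ' ^ 2) ∧
      (γ' < 0 → 0 < lamb'.re) ∧ (0 < γ' → lamb'.re < 0) := by
  have hd := (genPoly_differentiable n A B
    (Complex.I * ωH, Complex.exp (-(Complex.I * ωH * τH)))).hasFDerivAt
  set L := fderiv ℂ (fun p : ℂ × ℂ => genPoly n A B p.1 p.2)
    (Complex.I * ωH, Complex.exp (-(Complex.I * ωH * τH))) with hLdef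
  set Y0 := Complex.exp (-(Complex.I * ωH * τH)) with hY0
  have hY0ne : Y0 ≠ 0 := Complex.exp_ne_zero _
  have hb : L (0, 1) ≠ 0 := by
    have := hd.comp_hasDerivAt Y0
      ((hasDerivAt_const Y0 (Complex.I * (ωH : ℂ))).prodMk (hasDerivAt_id Y0))
    have h2 : deriv (fun Y : ℂ => genPoly n A B (Complex.I * ωH) Y) Y0 = L (0, 1) := this.deriv
    rwa [h2] at hYd
  have e1 : Complex.exp (-(γ ωH : ℂ) - Complex.I * (φ ωH : ℂ)) = Y0 := by
    rw [hγ0, hφ0, hY0]; congr 1; push_cast; ring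
  have e2 : Complex.exp (-(τH : ℂ) * lamb τH) = Y0 := by
    rw [hlamb0, hY0]; congr 1; ring
  have e3 : Complex.exp (-(τH : ℂ) * (Complex.I * ωH)) = Y0 := by rw [← hlamb0, e2]
  have c1 := genPoly_chain n A B (fun ω : ℝ => Complex.I * ω)
    (fun ω : ℝ => Complex.exp (-(γ ω : ℂ) - Complex.I * (φ ω : ℂ))) _ _ ωH L
    (by simpa only [e1] using hd)
    ((hasDerivAt_id ωH).ofReal_comp.const_mul Complex.I)
    ((hγ.ofReal_comp.neg.sub (hφ.ofReal_comp.const_mul Complex.I)).cexp) hACS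
  have c2 := genPoly_chain n A B lamb
    (fun τ : ℝ => Complex.exp (-(τ : ℂ) * lamb τ)) _ _ τH L
    (by simpa only [e3, hlamb0] using hd)
    hlamb
    (((hasDerivAt_id τH).ofReal_comp.neg.mul hlamb).cexp) hroot
  simp only [Pi.neg_apply, Pi.mul_apply, Pi.sub_apply, id, e1, hlamb0, e3, ofReal_one] at c1 c2
  have key : lamb' * ((φ' : ℂ) - τH - Complex.I * γ') = Complex.I * ωH := by
    apply mul_left_cancel₀ (mul_ne_zero hb hY0ne)
    have hI := Complex.I_sq
    linear_combination c2 + Complex.I * lamb' * c1 +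
      (L (0, 1) * Y0 * lamb' * φ' - lamb' * L (1, 0)) * hI
  have hre := congrArg Complex.re key
  have him := congrArg Complex.im key
  simp at hre him
  have hD : 0 < (τH - φ') ^ 2 + γ' ^ 2 := by
    by_contra hcon
    have h1 : γ' = 0 := by nlinarith [sq_nonneg (τH - φ'), sq_nonneg γ']
    have h2 : τH - φ' = 0 := by nlinarith [sq_nonneg (τH - φ'), sq_nonneg γ']
    have h3 : φ' = τH := by linarith
    subst h1 h3
    simp at him
    linarith
  have hmain : lamb'.re = -ωH * γ' / ((τH - φ') ^ 2 + γ' ^ 2) := by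
    rw [eq_div_iff hD.ne']
    linear_combination (φ' - τH) * hre - γ' * him
  refine ⟨hmain, fun h => ?_, fun h => ?_⟩
  · rw [hmain]
    exact div_pos (by nlinarith) hD
  · rw [hmain]
    exact div_neg_of_neg_of_pos (by nlinarith) hD
end

section
/- Let a, b ∈ ℝ with |b| > |a|, set ω_H = √(b² − a²), and let φ_H ∈ ℝ be a fixed real number with e^{−i·φ_H} = (i·ω_H − a)/b. Then for every ω > 0 and τ > 0, the number iω is a root of the characteristic equation λ − a − b·e^{−λτ} = 0 if and only if ω = ω_H and there exists an integer k with ω·τ = φ_H + 2πk. -/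
open Complex

/-- **Critical roots of the scalar DDE.** For `|b| > |a|`, `ω_H = √(b² − a²)` and
`e^{−i φ_H} = (i ω_H − a)/b`, the number `iω` (with `ω > 0`) is a root of the
characteristic equation `λ − a − b e^{−λτ} = 0` iff `ω = ω_H` and
`ωτ = φ_H + 2πk` for some integer `k`. -/
theorem stmt3 (a b : ℝ) (hab : |a| < |b|)
    (ωH : ℝ) (hωH : ωH = Real.sqrt (b ^ 2 - a ^ 2))
    (φH : ℝ) (hφH : Complex.exp (-(Complex.I * φH)) = (Complex.I * ωH - a) / b) :
    ∀ ω : ℝ, 0 < ω → ∀ τ : ℝ, 0 < τ →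
      ((Complex.I * ω - a - b * Complex.exp (-(Complex.I * ω) * τ) = 0) ↔
        (ω = ωH ∧ ∃ k : ℤ, ω * τ = φH + 2 * Real.pi * k)) := by
  intro ω hω τ hτ
  have hb : b ≠ 0 := by
    rintro rfl
    simp only [abs_zero] at hab
    exact absurd (abs_nonneg a) (not_le.mpr hab)
  have hbc : (b : ℂ) ≠ 0 := by exact_mod_cast hb
  have key : Complex.exp (-(Complex.I * ω) * τ) = Complex.exp (-(Complex.I * φH)) ↔
      ∃ k : ℤ, ω * τ = φH + 2 * Real.pi * k := by
    rw [Complex.exp_eq_exp_iff_exists_int]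
    constructor
    · rintro ⟨n, hn⟩
      refine ⟨-n, ?_⟩
      have := congrArg Complex.im hn
      simp at this
      push_cast
      linarith
    · rintro ⟨k, hk⟩
      refine ⟨-k, ?_⟩
      have hk' : (ω : ℂ) * τ = φH + 2 * Real.pi * k := by exact_mod_cast hk
      push_cast
      linear_combination (-Complex.I) * hk'
  constructor
  · intro h
    have hω' : ω = ωH := by
      have e : -(Complex.I * ω) * τ = ((-(ω * τ) : ℝ) : ℂ) * Complex.I := by
        push_cast; ring
      have h' := h
      rw [e, Complex.exp_mul_I, ← Complex.ofReal_cos, ← Complex.ofReal_sin] at h'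
      have h1 := congrArg Complex.re h'
      have h2 := congrArg Complex.im h'
      simp [-Complex.ofReal_cos, -Complex.ofReal_sin] at h1 h2
      have h3 := Real.sin_sq_add_cos_sq (ω * τ)
      rw [hωH]
      have ha : a = -(b * Real.cos (ω * τ)) := by linarith
      have hw : ω = -(b * Real.sin (ω * τ)) := by linarith
      have hw2 : ω ^ 2 = (b * Real.sin (ω * τ)) ^ 2 := by
        rw [← neg_sq (b * _), ← hw]
      have ha2 : a ^ 2 = (b * Real.cos (ω * τ)) ^ 2 := by
        rw [← neg_sq (b * _), ← ha]
      have hs : b ^ 2 - a ^ 2 = ω ^ 2 := by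
        linear_combination -hw2 - ha2 - b ^ 2 * h3
      rw [hs, Real.sqrt_sq hω.le]
    refine ⟨hω', key.mp ?_⟩
    rw [hφH, ← hω', eq_div_iff hbc]
    linear_combination -h
  · rintro ⟨hw, hk⟩
    rw [key.mpr hk, hφH, ← hw]
    field_simp
    ring
end

section
/- Let a, b ∈ ℝ with |b| > |a|, set ω_H = √(b² − a²), and let τ_H > 0 satisfy e^{−i·ω_H·τ_H} = (i·ω_H − a)/b. If λ : ℝ → ℂ is differentiable at τ_H with λ(τ_H) = i·ω_H and λ(τ) − a − b·e^{−τ·λ(τ)} = 0 for all τ in a neighborhood of τ_H, then Re λ'(τ_H) > 0. -/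
open Complex

/-- **Destabilizing crossings of the scalar DDE.** For `|b| > |a|`,
`ω_H = √(b² − a²)`, `τ_H > 0` with `e^{−i ω_H τ_H} = (i ω_H − a)/b`, any family
of characteristic roots `λ(τ)` through `λ(τ_H) = i ω_H` crosses to the right:
`Re λ'(τ_H) > 0`. -/
theorem stmt4 (a b : ℝ) (hab : |a| < |b|)
    (ωH : ℝ) (hωH : ωH = Real.sqrt (b ^ 2 - a ^ 2))
    (τH : ℝ) (hτH : 0 < τH)
    (hcrit : Complex.exp (-(Complex.I * ωH * τH)) = (Complex.I * ωH - a) / b)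
    (lamb : ℝ → ℂ) (lamb' : ℂ)
    (hlamb : HasDerivAt lamb lamb' τH) (hlamb0 : lamb τH = Complex.I * ωH)
    (hroot : ∀ᶠ τ : ℝ in nhds τH,
      lamb τ - a - b * Complex.exp (-(τ : ℂ) * lamb τ) = 0) :
    0 < lamb'.re := by
  have hsq : a ^ 2 < b ^ 2 := sq_lt_sq.mpr hab
  have hω : 0 < ωH := by rw [hωH]; exact Real.sqrt_pos.mpr (by linarith)
  have hb : (b : ℂ) ≠ 0 := by
    intro h
    have hb0 : b = 0 := by exact_mod_cast h
    rw [hb0] at hsq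
    nlinarith [sq_nonneg a]
  have hid : HasDerivAt (fun τ : ℝ => -(τ : ℂ)) (-1) τH :=
    (Complex.ofRealCLM.hasDerivAt (x := τH)).neg
  have hd := (hlamb.sub_const (a : ℂ)).sub (((hid.mul hlamb).cexp).const_mul (b : ℂ))
  have h0 : HasDerivAt (fun _ : ℝ => (0 : ℂ)) 0 τH := hasDerivAt_const _ _
  have heq := hd.unique (h0.congr_of_eventuallyEq hroot)
  have he : Complex.exp (-(τH : ℂ) * lamb τH) = (Complex.I * ωH - a) / b := by
    rw [hlamb0, ← hcrit]; congr 1; ring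
  simp only [Pi.mul_apply] at heq
  rw [he, hlamb0, ← mul_assoc, mul_div_cancel₀ _ hb] at heq
  have hre := congrArg Complex.re heq
  have him := congrArg Complex.im heq
  simp at hre him
  have key : lamb'.re * ((1 - τH * a) ^ 2 + (τH * ωH) ^ 2) = ωH ^ 2 := by
    linear_combination (1 - τH * a) * hre + τH * ωH * him
  have hpos : 0 < (1 - τH * a) ^ 2 + (τH * ωH) ^ 2 := by positivity
  by_contra hcon
  nlinarith [mul_nonneg (sub_nonneg.mpr (not_lt.mp hcon)) hpos.le, pow_pos hω 2]
end

section
/- Let a, b ∈ ℝ with |b| < |a| and a + b < 0. Then for every τ ≥ 0, every root λ ∈ ℂ of the characteristic equation λ − a − b·e^{−λτ} = 0 satisfies Re λ < 0. -/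
open Complex

/-- **Absolute stability of the scalar DDE.** If `|b| < |a|` and `a + b < 0`, then
for every delay `τ ≥ 0`, every root of `λ − a − b e^{−λτ} = 0` has negative real
part. -/
theorem stmt5 (a b : ℝ) (hba : |b| < |a|) (hab : a + b < 0) :
    ∀ τ : ℝ, 0 ≤ τ → ∀ lamb : ℂ,
      lamb - a - b * Complex.exp (-lamb * τ) = 0 → lamb.re < 0 := by
  intro τ hτ lamb h
  by_contra hre
  have hre : 0 ≤ lamb.re := not_lt.mp hre
  have ha : a < 0 := by
    by_contra h0
    have h0 : 0 ≤ a := not_lt.mp h0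
    rw [abs_of_nonneg h0] at hba
    have := neg_abs_le b
    linarith
  rw [abs_of_neg ha] at hba
  have h1 : lamb - a = b * Complex.exp (-lamb * τ) := sub_eq_zero.mp h
  have h2 : ‖lamb - a‖ = |b| * Real.exp (-(lamb.re * τ)) := by
    rw [h1, norm_mul, Complex.norm_exp, Complex.norm_real, Real.norm_eq_abs]
    simp
  have h3 : Real.exp (-(lamb.re * τ)) ≤ 1 := by
    rw [Real.exp_le_one_iff]
    have := mul_nonneg hre hτ
    linarith
  have h4 : lamb.re - a ≤ ‖lamb - a‖ := by
    have := Complex.re_le_norm (lamb - a)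
    simpa using this
  have h5 := mul_le_mul_of_nonneg_left h3 (abs_nonneg b)
  linarith
end

section
/- Let α, β, μ ∈ ℝ with α ≠ 0, β > 0, μ ≠ 0. Define g : ℝ → ℝ by g(ω) = ln|μ| − (1/2)·ln(α² + (ω − β)²). Then the following are equivalent: (i) there exist ω_{H1} > ω_{H2} > 0 such that g(ω_{H1}) = g(ω_{H2}) = 0, g(ω) > 0 for all ω ∈ (ω_{H2}, ω_{H1}), and g(ω) < 0 for all ω ∈ ℝ \ [ω_{H2}, ω_{H1}]; (ii) α² < μ² and α² + β² > μ². Moreover, when these hold, ω_{H1} = β + √(μ² − α²) and ω_{H2} = β − √(μ² − α²). -/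
/-- The class II property for one branch `g` of the asymptotic continuous spectrum:
`g` vanishes at `ω₁ > ω₂ > 0`, is positive exactly on `(ω₂, ω₁)` and negative
outside `[ω₂, ω₁]`. -/
def IsClassIIBranch (g : ℝ → ℝ) (ω₁ ω₂ : ℝ) : Prop :=
  0 < ω₂ ∧ ω₂ < ω₁ ∧ g ω₁ = 0 ∧ g ω₂ = 0 ∧
    (∀ ω ∈ Set.Ioo ω₂ ω₁, 0 < g ω) ∧
    (∀ ω : ℝ, ω ∉ Set.Icc ω₂ ω₁ → g ω < 0)

/-- **Class II criterion for the Stuart–Landau-type system**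
`A = [[α, β], [−β, α]]`, `B = μ I`, whose ACS branch is
`g(ω) = ln|μ| − ½ ln(α² + (ω − β)²)`. -/
theorem stmt11 (α β μ : ℝ) (hα : α ≠ 0) (hβ : 0 < β) (hμ : μ ≠ 0)
    (g : ℝ → ℝ)
    (hg : ∀ ω : ℝ, g ω = Real.log |μ| - (1 / 2) * Real.log (α ^ 2 + (ω - β) ^ 2)) :
    ((∃ ω₁ ω₂ : ℝ, IsClassIIBranch g ω₁ ω₂) ↔
        (α ^ 2 < μ ^ 2 ∧ μ ^ 2 < α ^ 2 + β ^ 2)) ∧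
      (∀ ω₁ ω₂ : ℝ, IsClassIIBranch g ω₁ ω₂ →
        ω₁ = β + Real.sqrt (μ ^ 2 - α ^ 2) ∧ ω₂ = β - Real.sqrt (μ ^ 2 - α ^ 2)) := by
  have hpos : ∀ ω : ℝ, 0 < α ^ 2 + (ω - β) ^ 2 := fun ω => by positivity
  have hμ2 : 0 < μ ^ 2 := by positivity
  have hg' : ∀ ω : ℝ, g ω = (1 / 2) * (Real.log (μ ^ 2) - Real.log (α ^ 2 + (ω - β) ^ 2)) := by
    intro ω
    rw [hg, Real.log_abs, Real.log_pow]
    push_cast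
    ring
  have h0 : ∀ ω : ℝ, g ω = 0 → α ^ 2 + (ω - β) ^ 2 = μ ^ 2 := by
    intro ω h
    rw [hg'] at h
    exact Real.log_injOn_pos (hpos ω) hμ2 (by linarith)
  have key : ∀ ω₁ ω₂ : ℝ, IsClassIIBranch g ω₁ ω₂ →
      0 < ω₁ - β ∧ ω₂ = β - (ω₁ - β) ∧ (ω₁ - β) ^ 2 = μ ^ 2 - α ^ 2 ∧ ω₁ - β < β := by
    rintro ω₁ ω₂ ⟨hp, hlt, h1, h2, -, -⟩
    have e1 := h0 _ h1
    have e2 := h0 _ h2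
    have e3 : (ω₁ - ω₂) * (ω₁ + ω₂ - 2 * β) = 0 := by linarith
    have e4 : ω₁ + ω₂ - 2 * β = 0 := by
      rcases mul_eq_zero.mp e3 with h | h
      · linarith
      · exact h
    refine ⟨?_, ?_, ?_, ?_⟩ <;> linarith
  refine ⟨⟨?_, ?_⟩, ?_⟩
  · rintro ⟨ω₁, ω₂, h⟩
    obtain ⟨a, b, c, d⟩ := key _ _ h
    constructor <;> nlinarith
  · rintro ⟨h1, h2⟩
    have hs : 0 < Real.sqrt (μ ^ 2 - α ^ 2) := Real.sqrt_pos.mpr (by linarith)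
    have hs2 : Real.sqrt (μ ^ 2 - α ^ 2) ^ 2 = μ ^ 2 - α ^ 2 := Real.sq_sqrt (by linarith)
    generalize Real.sqrt (μ ^ 2 - α ^ 2) = s at hs hs2
    have hsβ : s < β := by nlinarith
    refine ⟨β + s, β - s, by linarith, by linarith, ?_, ?_, ?_, ?_⟩
    · rw [hg', show α ^ 2 + (β + s - β) ^ 2 = μ ^ 2 by linarith]
      ring
    · rw [hg', show α ^ 2 + (β - s - β) ^ 2 = μ ^ 2 by linarith]
      ring
    · rintro ω ⟨ha, hb⟩
      have : α ^ 2 + (ω - β) ^ 2 < μ ^ 2 := by nlinarith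
      have := Real.log_lt_log (hpos ω) this
      rw [hg']
      linarith
    · intro ω hω
      have : μ ^ 2 < α ^ 2 + (ω - β) ^ 2 := by
        by_contra hc
        have hab := abs_le_of_sq_le_sq' (show (ω - β) ^ 2 ≤ s ^ 2 by linarith) hs.le
        exact hω ⟨by linarith [hab.1], by linarith [hab.2]⟩
      have := Real.log_lt_log hμ2 this
      rw [hg']
      linarith
  · intro ω₁ ω₂ h
    obtain ⟨a, b, c, d⟩ := key _ _ h
    rw [← c, Real.sqrt_sq a.le]
    exact ⟨by ring, b⟩
end

section
/- Let A, B be real 2×2 matrices with det(B) ≠ det(A), and let C = det(A + B) − det(A) − det(B). Suppose Y : ℝ → ℂ is differentiable at 0, Y(0) = 1, and det(B)·Y(ω)² + (C − iω·tr(B))·Y(ω) + (det(A) − iω·tr(A) − ω²) = 0 for all ω in a neighborhood of 0. Then Y'(0) = i·(tr(A) + tr(B)) / (det(B) − det(A)). -/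
open Matrix Complex

/-- **Derivative of the ACS branch through `Y = 1`** for a two-variable DDE. -/
theorem stmt14 (A B : Matrix (Fin 2) (Fin 2) ℝ) (hAB : B.det ≠ A.det)
    (C : ℝ) (hC : C = (A + B).det - A.det - B.det)
    (Y : ℝ → ℂ) (Y' : ℂ)
    (hY : HasDerivAt Y Y' 0) (hY0 : Y 0 = 1)
    (hroot : ∀ᶠ ω : ℝ in nhds 0,
      (B.det : ℂ) * (Y ω) ^ 2 + ((C : ℂ) - Complex.I * ω * (B.trace : ℝ)) * Y ω
        + ((A.det : ℂ) - Complex.I * ω * (A.trace : ℝ) - (ω : ℂ) ^ 2) = 0) :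
    Y' = Complex.I * ((A.trace + B.trace : ℝ) : ℂ) / ((B.det - A.det : ℝ) : ℂ) := by
  have h0 := hroot.self_of_nhds
  simp only [hY0, Complex.ofReal_zero] at h0
  have hid : HasDerivAt (fun ω : ℝ => (ω : ℂ)) 1 0 := Complex.ofRealCLM.hasDerivAt
  have h1 := ((hY.pow 2).const_mul (B.det : ℂ)).add
    ((((hid.const_mul Complex.I).mul_const ((B.trace : ℝ) : ℂ)).const_sub (C : ℂ)).mul hY)
  have h2 := h1.add
    ((((hid.const_mul Complex.I).mul_const ((A.trace : ℝ) : ℂ)).const_sub (A.det : ℂ)).sub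
      (hid.pow 2))
  have h3 := (hasDerivAt_const (0 : ℝ) (0 : ℂ)).congr_of_eventuallyEq hroot
  have h4 := h2.unique h3
  simp only [hY0, Complex.ofReal_zero] at h4
  have hne : ((B.det - A.det : ℝ) : ℂ) ≠ 0 := by
    exact_mod_cast sub_ne_zero.mpr hAB
  rw [eq_div_iff hne]
  push_cast at h4 ⊢
  linear_combination h4 - Y' * h0
end

section
/- Let A, B be real 2×2 matrices with det(B) ≠ det(A), and let C = det(A + B) − det(A) − det(B). Suppose Y : ℝ → ℂ is differentiable in a neighborhood of 0 and twice differentiable at 0, Y(0) = 1, and det(B)·Y(ω)² + (C − iω·tr(B))·Y(ω) + (det(A) − iω·tr(A) − ω²) = 0 for all ω in a neighborhood of 0. Then, with ν₁ = tr(A) + tr(B) and ν₂ = det(B) − det(A), Y''(0) = (2/ν₂)·(1 − (ν₁/ν₂)·tr(B) + (ν₁/ν₂)²·det(B)). -/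
open Matrix Complex

/-- **Second derivative of the ACS branch through `Y = 1`** for a two-variable DDE.
With `ν₁ = tr A + tr B` and `ν₂ = det B − det A`,
`Y''(0) = (2/ν₂)(1 − (ν₁/ν₂) tr B + (ν₁/ν₂)² det B)`. -/
theorem stmt15 (A B : Matrix (Fin 2) (Fin 2) ℝ) (hAB : B.det ≠ A.det)
    (C : ℝ) (hC : C = (A + B).det - A.det - B.det)
    (Y : ℝ → ℂ) (Y' : ℝ → ℂ) (Y'' : ℂ)
    (hY : ∀ᶠ ω : ℝ in nhds 0, HasDerivAt Y (Y' ω) ω)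
    (hY' : HasDerivAt Y' Y'' 0) (hY0 : Y 0 = 1)
    (hroot : ∀ᶠ ω : ℝ in nhds 0,
      (B.det : ℂ) * (Y ω) ^ 2 + ((C : ℂ) - Complex.I * ω * (B.trace : ℝ)) * Y ω
        + ((A.det : ℂ) - Complex.I * ω * (A.trace : ℝ) - (ω : ℂ) ^ 2) = 0) :
    Y'' = (2 / ((B.det - A.det : ℝ) : ℂ)) *
        (1 - (((A.trace + B.trace) / (B.det - A.det) : ℝ) : ℂ) * (B.trace : ℝ)
          + (((A.trace + B.trace) / (B.det - A.det) : ℝ) : ℂ) ^ 2 * (B.det : ℝ)) := by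
  clear hC
  have hne : ((B.det : ℂ) - (A.det : ℂ)) ≠ 0 := by
    rw [sub_ne_zero]; exact_mod_cast hAB
  push_cast
  generalize (B.det : ℂ) = b at *
  generalize (A.det : ℂ) = a at *
  generalize ((B.trace : ℝ) : ℂ) = s at *
  generalize ((A.trace : ℝ) : ℂ) = t at *
  generalize (C : ℂ) = c at *
  have hid : ∀ x : ℝ, HasDerivAt (fun ω : ℝ => (ω : ℂ)) 1 x := fun x =>
    Complex.ofRealCLM.hasDerivAt
  have h0 := hroot.self_of_nhds
  have hd : ∀ᶠ ω : ℝ in nhds 0,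
      b * (2 * Y ω * Y' ω) + (-(Complex.I * s) * Y ω + (c - Complex.I * ω * s) * Y' ω)
        + (-(Complex.I * t) - 2 * ω) = 0 := by
    filter_upwards [hroot.eventually_nhds, hY] with x hx hYx
    have h1 := (((hYx.pow 2).const_mul b).add
      (((((hid x).const_mul Complex.I).mul_const s).const_sub c).mul hYx)).add
      (((((hid x).const_mul Complex.I).mul_const t).const_sub a).sub ((hid x).pow 2))
    have h2 := h1.unique ((hasDerivAt_const x (0 : ℂ)).congr_of_eventuallyEq hx)
    rw [← h2]
    push_cast
    ring
  have hd0 := hd.self_of_nhds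
  have hY1 := hY.self_of_nhds
  have h1 := ((((hY1.const_mul 2).mul hY').const_mul b).add
    ((hY1.const_mul (-(Complex.I * s))).add
      (((((hid 0).const_mul Complex.I).mul_const s).const_sub c).mul hY'))).add
    (((hid 0).const_mul 2).const_sub (-(Complex.I * t)))
  have h2 := h1.unique ((hasDerivAt_const (0 : ℝ) (0 : ℂ)).congr_of_eventuallyEq hd)
  simp only [hY0, Complex.ofReal_zero] at h0 hd0 h2
  have hc : c = -a - b := by linear_combination h0
  subst hc
  have hy : Y' 0 = Complex.I * ((t + s) / (b - a)) := by
    field_simp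
    linear_combination hd0
  have hr : (b - a) * ((t + s) / (b - a)) = t + s := by field_simp
  rw [hy] at h2
  generalize (t + s) / (b - a) = r at *
  rw [div_mul_eq_mul_div, eq_div_iff hne]
  linear_combination h2 + (2 * s * r - 2 * b * r ^ 2) * Complex.I_sq
end

section
/- Let A, B be real 2×2 matrices, let C = det(A + B) − det(A) − det(B), and set ν₄ = det(A + B) − det(A) − 3·det(B); assume ν₄ ≠ 0. Suppose Y : ℝ → ℂ is differentiable at 0, Y(0) = −1, and det(B)·Y(ω)² + (C − iω·tr(B))·Y(ω) + (det(A) − iω·tr(A) − ω²) = 0 for all ω in a neighborhood of 0. Then Y'(0) = i·(tr(A) − tr(B)) / ν₄. -/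
open Matrix Complex

/-- **Derivative of the ACS branch through `Y = −1`** for a two-variable DDE.
With `ν₄ = det(A+B) − det A − 3 det B ≠ 0`, `Y'(0) = i (tr A − tr B)/ν₄`. -/
theorem stmt17 (A B : Matrix (Fin 2) (Fin 2) ℝ)
    (C ν₄ : ℝ) (hC : C = (A + B).det - A.det - B.det)
    (hν₄ : ν₄ = (A + B).det - A.det - 3 * B.det) (hν₄0 : ν₄ ≠ 0)
    (Y : ℝ → ℂ) (Y' : ℂ)
    (hY : HasDerivAt Y Y' 0) (hY0 : Y 0 = -1)
    (hroot : ∀ᶠ ω : ℝ in nhds 0,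
      (B.det : ℂ) * (Y ω) ^ 2 + ((C : ℂ) - Complex.I * ω * (B.trace : ℝ)) * Y ω
        + ((A.det : ℂ) - Complex.I * ω * (A.trace : ℝ) - (ω : ℂ) ^ 2) = 0) :
    Y' = Complex.I * ((A.trace - B.trace : ℝ) : ℂ) / (ν₄ : ℂ) := by
  have hid : HasDerivAt (fun ω : ℝ => (ω : ℂ)) 1 0 := by
    simpa using (hasDerivAt_id (0 : ℝ)).ofReal_comp
  have hF := (((hY.pow 2).const_mul (B.det : ℂ)).add
    ((((hid.const_mul Complex.I).mul_const ((B.trace : ℝ) : ℂ)).const_sub (C : ℂ)).mul hY)).add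
    ((((hid.const_mul Complex.I).mul_const ((A.trace : ℝ) : ℂ)).const_sub (A.det : ℂ)).sub
      (hid.pow 2))
  have h0 : HasDerivAt (fun _ : ℝ => (0 : ℂ)) 0 0 := hasDerivAt_const _ _
  have h1 := h0.congr_of_eventuallyEq (f₁ := fun ω : ℝ =>
    (B.det : ℂ) * (Y ω) ^ 2 + ((C : ℂ) - Complex.I * ω * (B.trace : ℝ)) * Y ω
        + ((A.det : ℂ) - Complex.I * ω * (A.trace : ℝ) - (ω : ℂ) ^ 2)) hroot
  have h2 := hF.unique h1
  simp [hY0] at h2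
  have hν : (ν₄ : ℂ) = C - 2 * B.det := by
    rw [hν₄, hC]; push_cast; ring
  have hne : (ν₄ : ℂ) ≠ 0 := by exact_mod_cast hν₄0
  rw [eq_div_iff hne, hν]
  push_cast
  linear_combination h2
end

section
/- Let α, β ∈ ℝ with |α| < 1, and let φ₊, φ₋ ∈ ℝ be fixed numbers with e^{−i·φ₊} = i·√(1 − α²) − α and e^{−i·φ₋} = −i·√(1 − α²) − α. Then for all ω ∈ ℝ and τ > 0, the equation iω − (α + iβ) − e^{−iωτ} = 0 holds if and only if either ω = β + √(1 − α²) and there exists an integer k with ωτ = φ₊ + 2πk, or ω = β − √(1 − α²) and there exists an integer k with ωτ = φ₋ + 2πk. -/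
open Complex

lemma exp_aux (x φ : ℝ) : Complex.exp (-(Complex.I * x)) = Complex.exp (-(Complex.I * φ)) ↔
    ∃ k : ℤ, x = φ + 2 * Real.pi * k := by
  rw [Complex.exp_eq_exp_iff_exists_int]
  constructor
  · rintro ⟨n, hn⟩
    refine ⟨-n, ?_⟩
    have h := congrArg Complex.im hn
    simp at h
    push_cast
    linarith
  · rintro ⟨k, rfl⟩
    refine ⟨-k, ?_⟩
    push_cast
    ring

lemma exp_aux_normSq (x : ℝ) :
    (Complex.exp (-(Complex.I * x))).re ^ 2 + (Complex.exp (-(Complex.I * x))).im ^ 2 = 1 := by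
  rw [Complex.exp_re, Complex.exp_im]
  simp

/-- **Purely imaginary characteristic roots of the linearized Stuart–Landau
oscillator with delayed feedback.** For `|α| < 1`, `iω` is a root of
`λ − (α + iβ) − e^{−λτ} = 0` iff `ω = β ± √(1 − α²)` with `ωτ ∈ φ_± + 2πℤ`. -/
theorem stmt19 (α β : ℝ) (hα : |α| < 1)
    (φp φm : ℝ)
    (hφp : Complex.exp (-(Complex.I * φp))
      = Complex.I * (Real.sqrt (1 - α ^ 2) : ℝ) - (α : ℂ))
    (hφm : Complex.exp (-(Complex.I * φm))
      = -Complex.I * (Real.sqrt (1 - α ^ 2) : ℝ) - (α : ℂ)) :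
    ∀ ω : ℝ, ∀ τ : ℝ, 0 < τ →
      ((Complex.I * ω - ((α : ℂ) + Complex.I * (β : ℂ))
          - Complex.exp (-(Complex.I * ω) * τ) = 0) ↔
        ((ω = β + Real.sqrt (1 - α ^ 2) ∧ ∃ k : ℤ, ω * τ = φp + 2 * Real.pi * k) ∨
         (ω = β - Real.sqrt (1 - α ^ 2) ∧ ∃ k : ℤ, ω * τ = φm + 2 * Real.pi * k))) := by
  intro ω τ _
  have hs : Real.sqrt (1 - α ^ 2) ^ 2 = 1 - α ^ 2 := by
    apply Real.sq_sqrt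
    have := (sq_lt_one_iff_abs_lt_one α).2 hα
    linarith
  rw [← exp_aux, ← exp_aux, hφp, hφm]
  have e : -(Complex.I * ω) * τ = -(Complex.I * ((ω * τ : ℝ) : ℂ)) := by push_cast; ring
  rw [e]
  have hn := exp_aux_normSq (ω * τ)
  generalize Complex.exp (-(Complex.I * ((ω * τ : ℝ) : ℂ))) = z at hn ⊢
  generalize Real.sqrt (1 - α ^ 2) = s at hs ⊢
  constructor
  · intro h
    have hz : z = Complex.I * ω - ((α : ℂ) + Complex.I * (β : ℂ)) := (sub_eq_zero.1 h).symm
    subst hz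
    simp at hn
    have h0 : (ω - (β + s)) * (ω - (β - s)) = 0 := by linear_combination hn - hs
    rcases mul_eq_zero.1 h0 with h1 | h1
    · left
      have h2 : ω = β + s := by linarith
      refine ⟨h2, ?_⟩
      rw [h2]; push_cast; ring
    · right
      have h2 : ω = β - s := by linarith
      refine ⟨h2, ?_⟩
      rw [h2]; push_cast; ring
  · rintro (⟨rfl, rfl⟩ | ⟨rfl, rfl⟩)
    · push_cast; ring
    · push_cast; ring
end
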